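/- Let u ≥ 2 and let F be a fixed nice u-graph with r = v(F) ≥ 4 vertices, and fix g = g(n) with g(n) → ∞ and g(n) = o(log n/log log n). Then one may couple the random F-graph process (H_t)_{t=0}^{M} on [n] with the random r-uniform hypergraph process (E_t)_{t=0}^{binom(n,r)} on [n] such that, with probability tending to 1 as n → ∞, both of the following hold: (a) T_H = T_E, where T_H (resp. T_E) is the first time at which the F-graph (resp. hypergraph) process has no isolated vertices; and (b) for every t ≤ T_H + ⌊g(n)·n⌋, the multihypergraph of vertex sets of the F-edges of H_t has no repeated hyperedge and equals E_t as a set of r-element subsets of [n]. -/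

import Mathlib

open Classical Filter Asymptotics MeasureTheory
open scoped ENNReal

noncomputable section

/-- The type of potential `F`-edges on vertex set `Fin n`: a pair consisting of the
`r`-element vertex set of the copy and the `u`-edge set of the copy. -/
abbrev FE (n : ℕ) := Finset (Fin n) × Finset (Finset (Fin n))

/-- `F` (a `u`-graph on `Fin r`) is strictly 1-balanced: every proper subgraph `(V', E')`
with more than one vertex has strictly smaller 1-density, i.e.
`e'/(v'-1) < e(F)/(r-1)`, written multiplicatively. -/
def StrictlyOneBalanced {r : ℕ} (F : Finset (Finset (Fin r))) : Prop :=
  ∀ (V' : Finset (Fin r)) (E' : Finset (Finset (Fin r))),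
    E' ⊆ F → (∀ e ∈ E', e ⊆ V') → 1 < V'.card → ¬(V' = Finset.univ ∧ E' = F) →
      E'.card * (r - 1) < F.card * (V'.card - 1)

/-- After deleting the vertices in `S`, the hypergraph `F` is connected. -/
def ConnectedAvoiding {r : ℕ} (F : Finset (Finset (Fin r))) (S : Finset (Fin r)) : Prop :=
  ∀ x y : Fin r, x ∉ S → y ∉ S →
    Relation.ReflTransGen (fun a b => ∃ e ∈ F, Disjoint e S ∧ a ∈ e ∧ b ∈ e) x y

/-- `F` is 3-connected: at least 4 vertices, and no set of at most 2 vertices disconnects it. -/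
def ThreeConnected {r : ℕ} (F : Finset (Finset (Fin r))) : Prop :=
  4 ≤ r ∧ ∀ S : Finset (Fin r), S.card ≤ 2 → ConnectedAvoiding F S

/-- Two edge sets on `Fin r` are isomorphic via a permutation of the vertices. -/
def EdgeIso {r : ℕ} (F F' : Finset (Finset (Fin r))) : Prop :=
  ∃ σ : Equiv.Perm (Fin r), F.image (fun e => e.image (fun x => σ x)) = F'

/-- `F` is nice: strictly 1-balanced, 3-connected and either `u ≥ 3` or `u = 2` and `F`
cannot be transformed into an isomorphic graph by adding one edge and deleting one edge. -/
def Nice {r : ℕ} (u : ℕ) (F : Finset (Finset (Fin r))) : Prop :=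
  StrictlyOneBalanced F ∧ ThreeConnected F ∧
    (3 ≤ u ∨ (u = 2 ∧ ¬ ∃ a b : Finset (Fin r), a.card = u ∧ a ∉ F ∧ b ∈ F ∧
      EdgeIso (insert a (F.erase b)) F))

/-- `h` is an `F`-edge on `[n]`: a copy of `F`, recorded as its (`r`-element) vertex set
together with its `u`-edge set. -/
def IsFEdge {r : ℕ} (F : Finset (Finset (Fin r))) (n : ℕ) (h : FE n) : Prop :=
  ∃ φ : Fin r ↪ Fin n, h.1 = Finset.univ.map φ ∧ h.2 = F.image (fun e => e.map φ)

/-- All possible `F`-edges on `[n]`. -/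
def allFEdges {r : ℕ} (F : Finset (Finset (Fin r))) (n : ℕ) : Finset (FE n) :=
  Finset.univ.filter (fun h => IsFEdge F n h)

/-- `M`, the total number of `F`-edges on `[n]`. -/
def Mnum {r : ℕ} (F : Finset (Finset (Fin r))) (n : ℕ) : ℕ := (allFEdges F n).card

/-- All `u`-element subsets of `[n]`. -/
def allUEdges (u n : ℕ) : Finset (Finset (Fin n)) :=
  Finset.univ.filter (fun e : Finset (Fin n) => e.card = u)

/-- The number of automorphisms of `F`. -/
def autCard {r : ℕ} (F : Finset (Finset (Fin r))) : ℕ :=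
  Fintype.card {σ : Equiv.Perm (Fin r) // F.image (fun e => e.image (fun x => σ x)) = F}

/-- The degree of a vertex `v` in an `F`-graph `H`. -/
def degFE {n : ℕ} (H : Finset (FE n)) (v : Fin n) : ℕ :=
  (H.filter (fun h => v ∈ h.1)).card

/-- Two `F`-edges are partners if their vertex sets share exactly `u` vertices. -/
def Partner (u : ℕ) {n : ℕ} (h h' : FE n) : Prop :=
  h ≠ h' ∧ (h.1 ∩ h'.1).card = u

/-- The state at time `t` of the process induced by the ordering `f`. -/
def proc {α : Type*} [DecidableEq α] {m : ℕ} (f : Fin m → α) (t : ℕ) : Finset α :=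
  (Finset.univ.filter (fun i : Fin m => (i : ℕ) < t)).image f

/-- A valid ordering of all `u`-element subsets of `[n]`. -/
def ValidOrdU (u n : ℕ) (f : Fin (Nat.choose n u) → Finset (Fin n)) : Prop :=
  Function.Injective f ∧ ∀ e : Finset (Fin n), e.card = u → ∃ i, f i = e

/-- A valid ordering of all `r`-element subsets of `[n]`. -/
def ValidOrdR (r n : ℕ) (f : Fin (Nat.choose n r) → Finset (Fin n)) : Prop :=
  Function.Injective f ∧ ∀ e : Finset (Fin n), e.card = r → ∃ i, f i = e

/-- A valid ordering of all `F`-edges on `[n]`. -/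
def ValidOrdH {r : ℕ} (F : Finset (Finset (Fin r))) (n : ℕ)
    (f : Fin (Mnum F n) → FE n) : Prop :=
  Function.Injective f ∧ ∀ h : FE n, IsFEdge F n h → ∃ i, f i = h

/-- `T_H`: the first time at which the `F`-graph process has no isolated vertices. -/
def THit {r : ℕ} (F : Finset (Finset (Fin r))) (n : ℕ) (f : Fin (Mnum F n) → FE n) : ℕ :=
  sInf {t : ℕ | ∀ v : Fin n, ∃ h ∈ proc f t, v ∈ h.1}

/-- `T_E`: the first time at which the `r`-uniform hypergraph process has no isolated
vertices. -/
def TEHit (r n : ℕ) (f : Fin (Nat.choose n r) → Finset (Fin n)) : ℕ :=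
  sInf {t : ℕ | ∀ v : Fin n, ∃ e ∈ proc f t, v ∈ e}

/-- `T_G`: the first time at which every vertex of `[n]` lies in a copy of `F` in the
`u`-graph process. -/
def TGHit (u : ℕ) {r : ℕ} (F : Finset (Finset (Fin r))) (n : ℕ)
    (f : Fin (Nat.choose n u) → Finset (Fin n)) : ℕ :=
  sInf {t : ℕ | ∀ v : Fin n, ∃ h : FE n, IsFEdge F n h ∧ v ∈ h.1 ∧ h.2 ⊆ proc f t}

/-- The random variable `X` is uniformly distributed over `{a | P a}` under `μ`. -/
def UniformOn {Ω α : Type*} (μ : PMF Ω) (X : Ω → α) (P : α → Prop) : Prop :=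
  μ.toOuterMeasure {ω | P (X ω)} = 1 ∧
    ∀ a b : α, P a → P b →
      μ.toOuterMeasure {ω | X ω = a} = μ.toOuterMeasure {ω | X ω = b}

/-- Under `μ`, the random set `X` contains each element of `all` independently with
probability `p` (a Bernoulli product / binomial random subset distribution). -/
def BernoulliVia {Ω E : Type*} (μ : PMF Ω) (X : Ω → Finset E)
    (all : Finset E) (p : ℝ) : Prop :=
  ∀ A : Finset E, μ.toOuterMeasure {ω | X ω = A} =
    if A ⊆ all then ENNReal.ofReal (p ^ A.card * (1 - p) ^ (all.card - A.card)) else 0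

/-- The function `g` tends to infinity and is `o(log n / log log n)`. -/
def GoodG (g : ℕ → ℝ) : Prop :=
  Tendsto g atTop atTop ∧ g =o[atTop] fun n : ℕ => Real.log n / Real.log (Real.log n)

/-- `π₊`, the probability at the end of the critical window. -/
def piPlus {r : ℕ} (F : Finset (Finset (Fin r))) (g : ℕ → ℝ) (n : ℕ) : ℝ :=
  ((autCard F : ℝ) / (Nat.factorial r : ℝ)) *
    ((Real.log n + g n) / ((n - 1).choose (r - 1) : ℝ))

/-- `π₋`, the probability at the start of the critical window. -/
def piMinus {r : ℕ} (F : Finset (Finset (Fin r))) (g : ℕ → ℝ) (n : ℕ) : ℝ :=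
  ((autCard F : ℝ) / (Nat.factorial r : ℝ)) *
    ((Real.log n - g n) / ((n - 1).choose (r - 1) : ℝ))

/-- `p₊ = (π₊/(1-n^{-δ}))^{1/s}` where `s = e(F)`. -/
def pPlus {r : ℕ} (F : Finset (Finset (Fin r))) (g : ℕ → ℝ) (δ : ℝ) (n : ℕ) : ℝ :=
  (piPlus F g n / (1 - (n : ℝ) ^ (-δ))) ^ ((1 : ℝ) / (F.card : ℝ))

/-- Connectivity (as a multihypergraph of vertex sets) of a set of `F`-edges. -/
def ConnFE {n : ℕ} (S : Finset (FE n)) : Prop :=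
  ∀ a ∈ S, ∀ b ∈ S,
    Relation.ReflTransGen (fun x y : FE n => x ∈ S ∧ y ∈ S ∧ (x.1 ∩ y.1).Nonempty) a b

/-- The multihypergraph of vertex sets of the `F`-edges of `H` contains an avoidable
configuration: a connected `S ⊆ H` with nullity `(r-1)e(S)+1-v(S) > 1` and
`e(S) ≤ 2^(r+1)`. -/
def HasAvoidable (r : ℕ) {n : ℕ} (H : Finset (FE n)) : Prop :=
  ∃ S ⊆ H, S.Nonempty ∧ ConnFE S ∧
    (S.sup Prod.fst).card < (r - 1) * S.card ∧ S.card ≤ 2 ^ (r + 1)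

/-- `G` contains an `F`-factor: pairwise vertex-disjoint copies of `F`, each a subgraph
of `G`, whose vertex sets partition `[n]`. -/
def HasFFactor {r : ℕ} (F : Finset (Finset (Fin r))) (n : ℕ)
    (G : Finset (Finset (Fin n))) : Prop :=
  ∃ C : Finset (FE n), (∀ h ∈ C, IsFEdge F n h ∧ h.2 ⊆ G) ∧
    (∀ h ∈ C, ∀ h' ∈ C, h ≠ h' → Disjoint h.1 h'.1) ∧
    C.sup Prod.fst = Finset.univ ∧ C.card * r = n

/-! ### Counting lemmas for uniformly random enumerations -/

section Generic

variable {X R Q : Type} [Fintype X] [Fintype R] [Fintype Q] [DecidableEq X] [DecidableEq R]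

set_option linter.unusedSectionVars false

/-- Enumerations of `X` whose first `k` entries avoid `S`. -/
def avoidSet (M : ℕ) (S : Finset X) (k : ℕ) : Finset (Fin M ≃ X) :=
  Finset.univ.filter (fun f => ∀ i : Fin M, (i : ℕ) < k → f i ∉ S)

theorem avoid_step (M : ℕ) (hM : Fintype.card X = M) (S : Finset X) (k : ℕ) :
    M * (avoidSet M S (k+1)).card ≤ (M - S.card) * (avoidSet M S k).card := by
  have h1 : ∀ j : Fin M, (avoidSet M S (k+1)).card ≤
      ((avoidSet M S k).filter (fun f => f j ∉ S)).card := by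
    intro j
    by_cases hj : (j : ℕ) < k
    · apply Finset.card_le_card
      intro f hf
      simp only [avoidSet, Finset.mem_filter, Finset.mem_univ, true_and] at hf ⊢
      exact ⟨fun i hi => hf i (by omega), hf j (by omega)⟩
    · have hk : k < M := by have := j.2; omega
      apply Finset.card_le_card_of_injOn (fun f => (Equiv.swap (⟨k, hk⟩ : Fin M) j).trans f)
      · intro f hf
        simp only [avoidSet, Finset.coe_filter, Set.mem_ofPred_eq, Finset.mem_filter,
          Finset.mem_univ, true_and, Equiv.trans_apply] at hf ⊢
        refine ⟨fun i hi => ?_, ?_⟩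
        · rw [Equiv.swap_apply_of_ne_of_ne]
          · exact hf i (by omega)
          · rintro rfl; simp at hi
          · rintro rfl; omega
        · rw [Equiv.swap_apply_right]
          exact hf _ (by simp)
      · intro f _ f' _ h
        ext x
        have := congrArg (fun e => e (Equiv.swap (⟨k, hk⟩ : Fin M) j x)) h
        simpa using this
  calc M * (avoidSet M S (k+1)).card = ∑ j : Fin M, (avoidSet M S (k+1)).card := by simp
    _ ≤ ∑ j : Fin M, ((avoidSet M S k).filter (fun f => f j ∉ S)).card :=
        Finset.sum_le_sum (fun j _ => h1 j)
    _ = ∑ f ∈ avoidSet M S k, (Finset.univ.filter (fun j => f j ∉ S)).card := by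
        simp only [Finset.card_filter]
        exact Finset.sum_comm
    _ = ∑ f ∈ avoidSet M S k, (M - S.card) := by
        apply Finset.sum_congr rfl
        intro f _
        have : (Finset.univ.filter (fun j => f j ∉ S)).card = (Sᶜ).card := by
          apply Finset.card_bij (fun j _ => f j)
          · intro a ha; simpa using ha
          · intro a _ b _ h; exact f.injective h
          · intro b hb; exact ⟨f.symm b, by simpa using hb, by simp⟩
        rw [this, Finset.card_compl, hM]
    _ = _ := by simp [mul_comm]

theorem avoid_bound (M : ℕ) (hM : Fintype.card X = M) (S : Finset X) (k : ℕ) :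
    M ^ k * (avoidSet M S k).card ≤ (M - S.card) ^ k * Fintype.card (Fin M ≃ X) := by
  induction k with
  | zero => simpa using Finset.card_le_univ _
  | succ k ih =>
    calc M ^ (k+1) * (avoidSet M S (k+1)).card = M ^ k * (M * (avoidSet M S (k+1)).card) := by ring
      _ ≤ M ^ k * ((M - S.card) * (avoidSet M S k).card) :=
        Nat.mul_le_mul_left _ (avoid_step M hM S k)
      _ = (M - S.card) * (M ^ k * (avoidSet M S k).card) := by ring
      _ ≤ (M - S.card) * ((M - S.card) ^ k * Fintype.card (Fin M ≃ X)) := Nat.mul_le_mul_left _ ih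
      _ = _ := by ring

theorem pair_bound (M K : ℕ) (p : X → R)
    (hK : ∀ ρ, (Finset.univ.filter (fun x => p x = ρ)).card ≤ K) (i j : Fin M) (hij : i ≠ j) :
    (M - 1) * (Finset.univ.filter (fun f : Fin M ≃ X => p (f i) = p (f j))).card
      ≤ K * Fintype.card (Fin M ≃ X) := by
  have h1 : ∀ j' ∈ Finset.univ.erase i,
      (Finset.univ.filter (fun f : Fin M ≃ X => p (f i) = p (f j))).card ≤
      (Finset.univ.filter (fun f : Fin M ≃ X => p (f i) = p (f j'))).card := by
    intro j' hj'
    have hj' : j' ≠ i := by simpa using hj'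
    apply Finset.card_le_card_of_injOn (fun f => (Equiv.swap j j').trans f)
    · intro f hf
      simp only [Finset.coe_filter, Set.mem_ofPred_eq, 
          Finset.mem_univ, true_and, Equiv.trans_apply] at hf ⊢
      rw [Equiv.swap_apply_of_ne_of_ne hij hj'.symm, Equiv.swap_apply_right]
      exact hf
    · intro f _ f' _ h
      ext x
      have := congrArg (fun e => e (Equiv.swap j j' x)) h
      simpa using this
  calc (M - 1) * (Finset.univ.filter (fun f : Fin M ≃ X => p (f i) = p (f j))).card
      = ∑ j' ∈ Finset.univ.erase i,
        (Finset.univ.filter (fun f : Fin M ≃ X => p (f i) = p (f j))).card := by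
        simp [Finset.card_erase_of_mem]
    _ ≤ ∑ j' ∈ Finset.univ.erase i,
        (Finset.univ.filter (fun f : Fin M ≃ X => p (f i) = p (f j'))).card :=
        Finset.sum_le_sum h1
    _ = ∑ f : Fin M ≃ X, ((Finset.univ.erase i).filter (fun j' => p (f i) = p (f j'))).card := by
        simp only [Finset.card_filter]
        exact Finset.sum_comm
    _ ≤ ∑ f : Fin M ≃ X, K := by
        apply Finset.sum_le_sum
        intro f _
        refine le_trans ?_ (hK (p (f i)))
        apply Finset.card_le_card_of_injOn (fun j => f j)
        · intro a ha
          simp at ha ⊢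
          exact ha.2.symm
        · intro a _ b _ h; exact f.injective h
    _ = _ := by simp [mul_comm]

/-- First time at which `ρ` appears as the projection of an entry of `e`. -/
def firstTime {M : ℕ} (p : X → R) (e : Fin M ≃ X) (ρ : R) : ℕ :=
  sInf {i : ℕ | ∃ h : i < M, p (e ⟨i, h⟩) = ρ}

theorem firstTime_mem {M : ℕ} (p : X → R) (hp : Function.Surjective p) (e : Fin M ≃ X) (ρ : R) :
    ∃ h : firstTime p e ρ < M, p (e ⟨_, h⟩) = ρ := by
  have : {i : ℕ | ∃ h : i < M, p (e ⟨i, h⟩) = ρ}.Nonempty := by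
    obtain ⟨x, hx⟩ := hp ρ
    exact ⟨(e.symm x : ℕ), (e.symm x).2, by simpa using hx⟩
  exact Nat.sInf_mem this

theorem firstTime_inj {M : ℕ} (p : X → R) (hp : Function.Surjective p) (e : Fin M ≃ X) :
    Function.Injective (firstTime p e) := by
  intro a b h
  obtain ⟨h1, h2⟩ := firstTime_mem p hp e a
  obtain ⟨h3, h4⟩ := firstTime_mem p hp e b
  rw [← h2, ← h4]
  congr 3

/-- Rank of `ρ` in the order of first appearance. -/
def rankApp {M : ℕ} (p : X → R) (e : Fin M ≃ X) (ρ : R) : ℕ :=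
  (Finset.univ.filter (fun ρ' => firstTime p e ρ' < firstTime p e ρ)).card

theorem rankApp_lt {M : ℕ} (p : X → R) (e : Fin M ≃ X) (ρ : R) :
    rankApp p e ρ < Fintype.card R := by
  apply Finset.card_lt_univ_of_notMem (x := ρ)
  simp

theorem rankApp_strict {M : ℕ} (p : X → R) (e : Fin M ≃ X) (a b : R)
    (h : firstTime p e a < firstTime p e b) : rankApp p e a < rankApp p e b := by
  apply Finset.card_lt_card
  rw [Finset.ssubset_iff_of_subset]
  · exact ⟨a, by simpa using h, by simp⟩
  · intro c hc
    simp at hc ⊢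
    omega

theorem rankApp_inj {M : ℕ} (p : X → R) (hp : Function.Surjective p) (e : Fin M ≃ X) :
    Function.Injective (rankApp p e) := by
  intro a b h
  by_contra hab
  rcases lt_or_gt_of_ne (fun h' => hab (firstTime_inj p hp e h')) with h' | h'
  · exact absurd h (rankApp_strict p e a b h').ne
  · exact absurd h (rankApp_strict p e b a h').ne'

/-- Enumeration of `R` in the order of first appearance. -/
def appOrder {M N : ℕ} (hN : Fintype.card R = N) (p : X → R) (hp : Function.Surjective p)
    (e : Fin M ≃ X) : Fin N ≃ R :=
  (Equiv.ofBijective (fun ρ => (⟨rankApp p e ρ, hN ▸ rankApp_lt p e ρ⟩ : Fin N))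
    ((Fintype.bijective_iff_injective_and_card _).2
      ⟨fun a b h => rankApp_inj p hp e (by simpa using h), by simpa using hN⟩)).symm

theorem appOrder_eq_iff {M N : ℕ} (hN : Fintype.card R = N) (p : X → R)
    (hp : Function.Surjective p) (e : Fin M ≃ X) (i : Fin N) (ρ : R) :
    appOrder hN p hp e i = ρ ↔ (i : ℕ) = rankApp p e ρ := by
  unfold appOrder
  rw [Equiv.symm_apply_eq]
  simp [Fin.ext_iff]

theorem appOrder_prefix {M N : ℕ} (hN : Fintype.card R = N) (p : X → R)
    (hp : Function.Surjective p) (e : Fin M ≃ X) (t : ℕ)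
    (hinj : ∀ i j : Fin M, (i : ℕ) < t → (j : ℕ) < t → p (e i) = p (e j) → i = j)
    (i : ℕ) (hi : i < t) (hiM : i < M) :
    ∃ h : i < N, appOrder hN p hp e ⟨i, h⟩ = p (e ⟨i, hiM⟩) := by
  have key : ∀ j (hj : j < M), j < t → firstTime p e (p (e ⟨j, hj⟩)) = j := by
    intro j hj hjt
    have hle : firstTime p e (p (e ⟨j, hj⟩)) ≤ j := Nat.sInf_le ⟨hj, rfl⟩
    obtain ⟨h1, h2⟩ := firstTime_mem p hp e (p (e ⟨j, hj⟩))
    have := hinj _ _ (by simp; omega) (by simpa using hjt) h2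
    simpa [Fin.ext_iff] using this
  have hr : rankApp p e (p (e ⟨i, hiM⟩)) = i := by
    unfold rankApp
    rw [key i hiM hi]
    conv_rhs => rw [← Finset.card_range i]
    apply Finset.card_bij (fun ρ _ => firstTime p e ρ)
    · intro a ha; simpa using ha
    · intro a _ b _ h; exact firstTime_inj p hp e h
    · intro b hb
      have hb : b < i := by simpa using hb
      have hk := key b (by omega) (by omega)
      refine ⟨p (e ⟨b, by omega⟩), ?_, hk⟩
      simp [hk, hb]
  have hlt : i < N := by
    have := rankApp_lt p e (p (e ⟨i, hiM⟩))
    omega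
  exact ⟨hlt, (appOrder_eq_iff hN p hp e _ _).2 hr.symm⟩

theorem appOrder_equivariant {M N : ℕ} (hN : Fintype.card R = N) (p : X → R)
    (hp : Function.Surjective p) (e : Fin M ≃ X) (π : R ≃ R) (piLift : X ≃ X)
    (hLift : ∀ x, p (piLift x) = π (p x)) :
    appOrder hN p hp (e.trans piLift) = (appOrder hN p hp e).trans π := by
  have h1 : ∀ ρ, firstTime p (e.trans piLift) (π ρ) = firstTime p e ρ := by
    intro ρ
    unfold firstTime
    simp [hLift]
  have h2 : ∀ ρ, rankApp p (e.trans piLift) (π ρ) = rankApp p e ρ := by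
    intro ρ
    unfold rankApp
    symm
    apply Finset.card_bij (fun ρ _ => π ρ)
    · intro a ha; simpa [h1] using ha
    · intro a _ b _ h; exact π.injective h
    · intro b hb
      refine ⟨π.symm b, ?_, by simp⟩
      have : firstTime p (e.trans piLift) b = firstTime p e (π.symm b) := by
        rw [← h1]; simp
      simpa [h1, this] using hb
  ext i : 1
  rw [appOrder_eq_iff, Equiv.trans_apply, h2, ← appOrder_eq_iff hN p hp e i]

theorem appOrder_uniform {M N : ℕ} (hN : Fintype.card R = N) (p : X → R)
    (hp : Function.Surjective p) (φ : X ≃ R × Q) (hφ : ∀ x, p x = (φ x).1) (s s' : Fin N ≃ R) :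
    (Finset.univ.filter (fun e : Fin M ≃ X => appOrder hN p hp e = s)).card =
    (Finset.univ.filter (fun e : Fin M ≃ X => appOrder hN p hp e = s')).card := by
  have main : ∀ s s' : Fin N ≃ R,
    (Finset.univ.filter (fun e : Fin M ≃ X => appOrder hN p hp e = s)).card ≤
    (Finset.univ.filter (fun e : Fin M ≃ X => appOrder hN p hp e = s')).card := by
    intro s s'
    let π : R ≃ R := s.symm.trans s'
    let piLift : X ≃ X := φ.trans ((Equiv.prodCongr π (Equiv.refl Q)).trans φ.symm)
    have hLift : ∀ x, p (piLift x) = π (p x) := by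
      intro x
      simp [piLift, hφ]
    apply Finset.card_le_card_of_injOn (fun e => e.trans piLift)
    · intro e he
      simp only [Finset.coe_filter, Set.mem_ofPred_eq, Finset.mem_univ, true_and] at he ⊢
      rw [appOrder_equivariant hN p hp e π piLift hLift, he]
      ext; simp [π]
    · intro e _ e' _ h
      ext x
      have := congrArg (fun e => piLift.symm (e x)) h
      simpa using this
  exact le_antisymm (main _ _) (main _ _)

end Generic

/-! ### The structure of the set of `F`-edges -/

/-- The `r`-subsets of `[n]`. -/
abbrev RS (r n : ℕ) := {s : Finset (Fin n) // s.card = r}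

/-- The type of `F`-edges. -/
abbrev XF {r : ℕ} (F : Finset (Finset (Fin r))) (n : ℕ) := {h : FE n // IsFEdge F n h}

/-- Copies of `F` on the vertex set `Fin r`. -/
abbrev QF {r : ℕ} (F : Finset (Finset (Fin r))) :=
  {E : Finset (Finset (Fin r)) // ∃ σ : Equiv.Perm (Fin r),
    E = F.image (fun e => e.map σ.toEmbedding)}

theorem card_XF {r : ℕ} (F : Finset (Finset (Fin r))) (n : ℕ) :
    Fintype.card (XF F n) = Mnum F n := by
  unfold Mnum allFEdges
  rw [Fintype.card_subtype]

theorem card_RS (r n : ℕ) : Fintype.card (RS r n) = n.choose r := by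
  simpa using Fintype.card_finset_len (α := Fin n) r

/-- The vertex set of an `F`-edge. -/
def pF {r : ℕ} (F : Finset (Finset (Fin r))) (n : ℕ) (x : XF F n) : RS r n :=
  ⟨x.1.1, by obtain ⟨φ, h, _⟩ := x.2; rw [h]; simp⟩

/-- Increasing parametrisation of an `r`-set. -/
def psiF {r n : ℕ} (s : RS r n) : Fin r ↪ Fin n := (s.1.orderEmbOfFin s.2).toEmbedding

theorem psiF_map {r n : ℕ} (s : RS r n) : Finset.univ.map (psiF s) = s.1 := by
  ext x
  have := Finset.range_orderEmbOfFin s.1 s.2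
  have h2 := Set.ext_iff.1 this x
  simpa [psiF] using h2

/-- Glue a vertex set and a copy of `F` on `Fin r` to an `F`-edge. -/
def glueF {r : ℕ} (F : Finset (Finset (Fin r))) (n : ℕ) (y : RS r n × QF F) : XF F n :=
  ⟨(y.1.1, y.2.1.image (fun e => e.map (psiF y.1))), by
    obtain ⟨s, ⟨E, σ, rfl⟩⟩ := y
    refine ⟨σ.toEmbedding.trans (psiF s), ?_, ?_⟩
    · rw [← Finset.map_map]; simp [psiF_map]
    · simp only [Finset.image_image]
      congr 1
      ext e : 1
      simp [Finset.map_map]⟩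

theorem glueF_bij {r : ℕ} (F : Finset (Finset (Fin r))) (n : ℕ) :
    Function.Bijective (glueF F n) := by
  constructor
  · rintro ⟨s, E⟩ ⟨s', E'⟩ h
    simp only [glueF, Subtype.mk.injEq, Prod.mk.injEq] at h
    obtain ⟨h1, h2⟩ := h
    have h1 : s = s' := Subtype.ext h1
    subst h1
    have := Finset.image_injective (Finset.map_injective (psiF s)) h2
    exact Prod.ext rfl (Subtype.ext this)
  · rintro ⟨⟨V, E⟩, φ, h1, h2⟩
    simp only at h1 h2
    have hV : V.card = r := by rw [h1]; simp
    let s : RS r n := ⟨V, hV⟩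
    have hmem : ∀ x, ∃ y, psiF s y = φ x := by
      intro x
      have : φ x ∈ Finset.univ.map (psiF s) := by
        rw [psiF_map]; change φ x ∈ V; rw [h1]; simp
      simpa using this
    choose σ hσ using hmem
    have hinj : Function.Injective σ := by
      intro a b h
      apply φ.injective
      rw [← hσ, ← hσ, h]
    let σ' : Equiv.Perm (Fin r) := Equiv.ofBijective σ (Finite.injective_iff_bijective.1 hinj)
    refine ⟨(s, ⟨_, σ', rfl⟩), ?_⟩
    apply Subtype.ext
    simp only [glueF]
    refine Prod.ext rfl ?_
    simp only [h2, Finset.image_image]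
    congr 1
    ext e : 1
    simp only [Function.comp, Finset.map_map]
    congr 1
    ext x : 1
    exact hσ x

/-- `F`-edges are pairs of a vertex set and a copy of `F` on `Fin r`. -/
def splitF {r : ℕ} (F : Finset (Finset (Fin r))) (n : ℕ) : XF F n ≃ RS r n × QF F :=
  (Equiv.ofBijective _ (glueF_bij F n)).symm

theorem splitF_fst {r : ℕ} (F : Finset (Finset (Fin r))) (n : ℕ) (x : XF F n) :
    pF F n x = (splitF F n x).1 := by
  obtain ⟨y, rfl⟩ := (splitF F n).symm.surjective x
  rw [Equiv.apply_symm_apply]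
  rfl

instance QF_nonempty {r : ℕ} (F : Finset (Finset (Fin r))) : Nonempty (QF F) :=
  ⟨⟨_, 1, rfl⟩⟩

theorem pF_surj {r : ℕ} (F : Finset (Finset (Fin r))) (n : ℕ) : Function.Surjective (pF F n) := by
  intro s
  refine ⟨(splitF F n).symm (s, Classical.arbitrary _), ?_⟩
  rw [splitF_fst]; simp

theorem Mnum_eq {r : ℕ} (F : Finset (Finset (Fin r))) (n : ℕ) :
    Mnum F n = n.choose r * Fintype.card (QF F) := by
  rw [← card_XF, Fintype.card_congr (splitF F n), Fintype.card_prod, card_RS]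

theorem fiber_card {r : ℕ} (F : Finset (Finset (Fin r))) (n : ℕ) (P : RS r n → Prop) :
    (Finset.univ.filter (fun x : XF F n => P (pF F n x))).card =
      (Finset.univ.filter P).card * Fintype.card (QF F) := by
  rw [← Finset.card_univ, ← Finset.card_product]
  apply Finset.card_bij (fun x _ => splitF F n x)
  · intro a ha; simpa [splitF_fst] using ha
  · intro a _ b _ h; exact (splitF F n).injective h
  · intro b hb
    exact ⟨(splitF F n).symm b, by simpa [splitF_fst] using hb, by simp⟩

theorem star_card {r n : ℕ} (hr : 1 ≤ r) (v : Fin n) :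
    n * (Finset.univ.filter (fun s : RS r n => v ∈ s.1)).card = r * n.choose r := by
  have h0 : (Finset.univ.filter (fun s : RS r n => ¬ v ∈ s.1)).card = (n-1).choose r := by
    have : (Finset.powersetCard r (Finset.univ.erase v)).card = (n-1).choose r := by
      rw [Finset.card_powersetCard]; simp [Finset.card_erase_of_mem]
    rw [← this]
    apply Finset.card_bij (fun s _ => s.1)
    · intro a ha
      simp only [Finset.mem_filter, Finset.mem_univ, true_and] at ha
      simp [Finset.mem_powersetCard, a.2, Finset.subset_erase, ha]
    · intro a _ b _ h; exact Subtype.ext h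
    · intro b hb
      rw [Finset.mem_powersetCard] at hb
      refine ⟨⟨b, hb.2⟩, ?_, rfl⟩
      simp only [Finset.mem_filter, Finset.mem_univ, true_and]
      intro h
      simpa using hb.1 h
  have h1 := Finset.card_filter_add_card_filter_not (s := (Finset.univ : Finset (RS r n)))
    (fun s : RS r n => v ∈ s.1)
  rw [h0, Finset.card_univ, card_RS] at h1
  obtain ⟨m, rfl⟩ : ∃ m, n = m + 1 := ⟨n - 1, by have := v.2; omega⟩
  obtain ⟨q, rfl⟩ : ∃ q, r = q + 1 := ⟨r - 1, by omega⟩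
  have h2 : (Finset.univ.filter (fun s : RS (q+1) (m+1) => v ∈ s.1)).card = m.choose q := by
    rw [Nat.choose_succ_succ] at h1
    simp at h1 ⊢
    omega
  rw [h2, mul_comm (q+1)]
  exact Nat.add_one_mul_choose_eq m q

/-! ### The coupling -/

/-- The coupled pair of orderings obtained from an enumeration of the `F`-edges. -/
def couple {r : ℕ} (F : Finset (Finset (Fin r))) (n : ℕ) (e : Fin (Mnum F n) ≃ XF F n) :
    (Fin (Mnum F n) → FE n) × (Fin (Nat.choose n r) → Finset (Fin n)) :=
  (fun i => (e i).1, fun i => (appOrder (card_RS r n) (pF F n) (pF_surj F n) e i).1)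

instance enum_nonempty {r : ℕ} (F : Finset (Finset (Fin r))) (n : ℕ) :
    Nonempty (Fin (Mnum F n) ≃ XF F n) :=
  ⟨(Fintype.equivFinOfCardEq (card_XF F n)).symm⟩

/-- The law of the coupled pair. -/
def muC {r : ℕ} (F : Finset (Finset (Fin r))) (n : ℕ) :
    PMF ((Fin (Mnum F n) → FE n) × (Fin (Nat.choose n r) → Finset (Fin n))) :=
  (PMF.uniformOfFintype (Fin (Mnum F n) ≃ XF F n)).map (couple F n)

theorem muC_apply {r : ℕ} (F : Finset (Finset (Fin r))) (n : ℕ)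
    (A : Set ((Fin (Mnum F n) → FE n) × (Fin (Nat.choose n r) → Finset (Fin n)))) :
    (muC F n).toOuterMeasure A =
      ((Finset.univ.filter (fun e => couple F n e ∈ A)).card : ℝ≥0∞) /
        (Fintype.card (Fin (Mnum F n) ≃ XF F n) : ℝ≥0∞) := by
  unfold muC
  rw [PMF.toOuterMeasure_map_apply, PMF.toOuterMeasure_uniformOfFintype_apply]
  congr 2
  rw [Fintype.card_subtype]
  rfl

theorem muC_all {r : ℕ} (F : Finset (Finset (Fin r))) (n : ℕ)
    (A : Set ((Fin (Mnum F n) → FE n) × (Fin (Nat.choose n r) → Finset (Fin n))))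
    (h : ∀ e, couple F n e ∈ A) : (muC F n).toOuterMeasure A = 1 := by
  rw [muC_apply, Finset.filter_true_of_mem (fun e _ => h e), Finset.card_univ]
  apply ENNReal.div_self
  · simp [Fintype.card_ne_zero]
  · simp

theorem muC_fst {r : ℕ} (F : Finset (Finset (Fin r))) (n : ℕ) :
    UniformOn (muC F n) Prod.fst (ValidOrdH F n) := by
  constructor
  · apply muC_all
    intro e
    refine ⟨fun i j h => e.injective (Subtype.ext h), fun h hh => ?_⟩
    exact ⟨e.symm ⟨h, hh⟩, by simp [couple]⟩
  · have main : ∀ a, ValidOrdH F n a → (Finset.univ.filter (fun e =>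
        couple F n e ∈ {ω | Prod.fst ω = a})).card = 1 := by
      intro a ha
      have hsurj : ∀ x : XF F n, ∃ i, a i = x.1 := fun x => ha.2 x.1 x.2
      choose b hb using hsurj
      have hbinj : Function.Injective b := by
        intro x y h
        apply Subtype.ext
        rw [← hb, ← hb, h]
      let e : XF F n ≃ Fin (Mnum F n) := Equiv.ofBijective b
        ((Fintype.bijective_iff_injective_and_card _).2 ⟨hbinj, by simpa using card_XF F n⟩)
      have he : ∀ i, (e.symm i).1 = a i := by
        intro i
        rw [← hb]
        congr 1
        exact e.apply_symm_apply i
      rw [Finset.card_eq_one]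
      refine ⟨e.symm, ?_⟩
      ext f
      simp only [Finset.mem_filter, Finset.mem_univ, true_and, Finset.mem_singleton]
      constructor
      · intro h
        ext i : 1
        apply Subtype.ext
        rw [he]
        exact congrFun h i
      · rintro rfl
        exact funext he
    intro a b ha hb
    have hab := (main a ha).trans (main b hb).symm
    rw [muC_apply, muC_apply]
    congr 1
    apply congrArg Nat.cast
    convert hab

theorem muC_snd {r : ℕ} (F : Finset (Finset (Fin r))) (n : ℕ) :
    UniformOn (muC F n) Prod.snd (ValidOrdR r n) := by
  constructor
  · apply muC_all
    intro e
    refine ⟨fun i j h => Equiv.injective _ (Subtype.ext h), fun h hh => ?_⟩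
    exact ⟨(appOrder (card_RS r n) (pF F n) (pF_surj F n) e).symm ⟨h, hh⟩, by simp [couple]⟩
  · have main : ∀ a, ValidOrdR r n a → ∃ s : Fin (n.choose r) ≃ RS r n, 
        (Finset.univ.filter (fun e => couple F n e ∈ {ω | Prod.snd ω = a})) =
        (Finset.univ.filter (fun e => appOrder (card_RS r n) (pF F n) (pF_surj F n) e = s)) := by
      intro a ha
      have hsurj : ∀ x : RS r n, ∃ i, a i = x.1 := fun x => ha.2 x.1 x.2
      choose b hb using hsurj
      have hbinj : Function.Injective b := by
        intro x y h
        apply Subtype.ext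
        rw [← hb, ← hb, h]
      let e : RS r n ≃ Fin (n.choose r) := Equiv.ofBijective b
        ((Fintype.bijective_iff_injective_and_card _).2 ⟨hbinj, by simpa using card_RS r n⟩)
      have he : ∀ i, (e.symm i).1 = a i := by
        intro i
        rw [← hb]
        congr 1
        exact e.apply_symm_apply i
      refine ⟨e.symm, ?_⟩
      ext f
      simp only [Finset.mem_filter, Finset.mem_univ, true_and]
      constructor
      · intro h
        ext i : 1
        apply Subtype.ext
        rw [he]
        exact congrFun h i
      · intro h
        change (fun i => (appOrder (card_RS r n) (pF F n) (pF_surj F n) f i).1) = a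
        rw [h]
        exact funext he
    intro a b ha hb
    obtain ⟨s, hs⟩ := main a ha
    obtain ⟨s', hs'⟩ := main b hb
    have hab := appOrder_uniform (M := Mnum F n) (card_RS r n) (pF F n) (pF_surj F n)
      (splitF F n) (splitF_fst F n) s s'
    have hab' := ((congrArg Finset.card hs).trans hab).trans (congrArg Finset.card hs').symm
    rw [muC_apply, muC_apply]
    congr 1
    apply congrArg Nat.cast
    convert hab'

/-- The good event of the theorem. -/
def goodEv {r : ℕ} (F : Finset (Finset (Fin r))) (n w : ℕ) :
    Set ((Fin (Mnum F n) → FE n) × (Fin (Nat.choose n r) → Finset (Fin n))) :=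
  {ω | THit F n ω.1 = TEHit r n ω.2 ∧
               ∀ t : ℕ, t ≤ THit F n ω.1 + w →
                 (∀ h ∈ proc ω.1 t, ∀ h' ∈ proc ω.1 t, h.1 = h'.1 → h = h') ∧
                 (proc ω.1 t).image Prod.fst = proc ω.2 t}

/-- The `F`-edges through `v`. -/
def starF {r : ℕ} (F : Finset (Finset (Fin r))) {n : ℕ} (v : Fin n) : Finset (XF F n) :=
  Finset.univ.filter (fun x => v ∈ (pF F n x).1)

theorem good_of {r : ℕ} (F : Finset (Finset (Fin r))) (n w k : ℕ) (hwk : w ≤ k)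
    (e : Fin (Mnum F n) ≃ XF F n)
    (h1 : ∀ v : Fin n, e ∉ avoidSet (Mnum F n) (starF F v) k)
    (h2 : ∀ i j : Fin (Mnum F n), (i : ℕ) < 2 * k → (j : ℕ) < 2 * k →
      pF F n (e i) = pF F n (e j) → i = j) :
    couple F n e ∈ goodEv F n w := by
  have hNM : n.choose r ≤ Mnum F n := by
    rw [Mnum_eq]; exact Nat.le_mul_of_pos_right _ Fintype.card_pos
  have hk : k ∈ {t : ℕ | ∀ v : Fin n, ∃ h ∈ proc (couple F n e).1 t, v ∈ h.1} := by
    intro v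
    have := h1 v
    simp only [avoidSet, Finset.mem_filter, Finset.mem_univ, true_and, not_forall, not_not] at this
    obtain ⟨i, hi, hv⟩ := this
    refine ⟨(e i).1, ?_, ?_⟩
    · simp only [proc, Finset.mem_image, Finset.mem_filter, Finset.mem_univ, true_and]
      exact ⟨i, hi, rfl⟩
    · exact (Finset.mem_filter.1 hv).2
  have hT : THit F n (couple F n e).1 ≤ k := Nat.sInf_le hk
  have himg : ∀ t ≤ 2 * k, (proc (couple F n e).1 t).image Prod.fst = proc (couple F n e).2 t := by
    intro t ht
    have hpre := appOrder_prefix (card_RS r n) (pF F n) (pF_surj F n) e t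
      (fun i j hi hj => h2 i j (by omega) (by omega))
    ext s
    simp only [proc, Finset.mem_image, Finset.mem_filter, Finset.mem_univ, true_and]
    constructor
    · rintro ⟨_, ⟨i, hi, rfl⟩, rfl⟩
      obtain ⟨h, h'⟩ := hpre i hi i.2
      exact ⟨⟨i, h⟩, hi, congrArg Subtype.val h'⟩
    · rintro ⟨i, hi, rfl⟩
      obtain ⟨h, h'⟩ := hpre i hi (lt_of_lt_of_le i.2 hNM)
      exact ⟨_, ⟨⟨i, lt_of_lt_of_le i.2 hNM⟩, hi, rfl⟩, (congrArg Subtype.val h').symm⟩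
  have hiff : ∀ t ≤ 2 * k, (∀ v : Fin n, ∃ h ∈ proc (couple F n e).1 t, v ∈ h.1) ↔
      (∀ v : Fin n, ∃ s ∈ proc (couple F n e).2 t, v ∈ s) := by
    intro t ht
    rw [← himg t ht]
    simp
  refine ⟨?_, ?_⟩
  · apply le_antisymm
    · have hB : {t : ℕ | ∀ v : Fin n, ∃ s ∈ proc (couple F n e).2 t, v ∈ s}.Nonempty :=
        ⟨k, (hiff k (by omega)).1 hk⟩
      have hle : TEHit r n (couple F n e).2 ≤ k := Nat.sInf_le ((hiff k (by omega)).1 hk)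
      exact Nat.sInf_le ((hiff _ (by omega)).2 (Nat.sInf_mem hB))
    · exact Nat.sInf_le ((hiff _ (by omega)).1 (Nat.sInf_mem ⟨k, hk⟩))
  · intro t ht
    have ht2 : t ≤ 2 * k := by omega
    refine ⟨?_, himg t ht2⟩
    intro h hh h' hh' heq
    simp only [proc, Finset.mem_image, Finset.mem_filter, Finset.mem_univ, true_and] at hh hh'
    obtain ⟨i, hi, rfl⟩ := hh
    obtain ⟨j, hj, rfl⟩ := hh'
    rw [h2 i j (by omega) (by omega) (Subtype.ext heq)]

theorem star_total {r : ℕ} (hr : 1 ≤ r) (F : Finset (Finset (Fin r))) {n : ℕ} (v : Fin n) :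
    n * (starF F v).card = r * Mnum F n := by
  have h2 : (starF F v).card = (Finset.univ.filter (fun s : RS r n => v ∈ s.1)).card *
      Fintype.card (QF F) := by
    unfold starF
    convert fiber_card F n (fun s => v ∈ s.1)
  rw [h2, ← mul_assoc, star_card hr v, Mnum_eq]
  ring

theorem avoid_real {r n s M d A Om : ℕ} (hr : 1 ≤ r) (hn : 1 ≤ n) (hM : 0 < M)
    (hstar : n * d = r * M) (hle : d ≤ M)
    (h1 : M ^ (n * s) * A ≤ (M - d) ^ (n * s) * Om) :
    (A : ℝ) ≤ Real.exp (-s) * Om := by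
  have hMpos : (0 : ℝ) < M := by exact_mod_cast hM
  have hnpos : (0 : ℝ) < n := by exact_mod_cast hn
  have h1' : (M : ℝ) ^ (n * s) * A ≤ ((M : ℝ) - d) ^ (n * s) * Om := by
    have := (Nat.cast_le (α := ℝ)).2 h1
    push_cast [Nat.cast_sub hle] at this
    exact this
  have hd : (M : ℝ) / n ≤ d := by
    rw [div_le_iff₀ hnpos]
    have : (n : ℝ) * d = r * M := by exact_mod_cast hstar
    have hr' : (1 : ℝ) ≤ r := by exact_mod_cast hr
    nlinarith
  have h3 : (M : ℝ) - d ≤ M * Real.exp (-(1 / n)) := by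
    have := Real.add_one_le_exp (-(1 / (n : ℝ)))
    have h4 : (M : ℝ) * (-(1 / (n : ℝ)) + 1) ≤ M * Real.exp (-(1 / n)) :=
      mul_le_mul_of_nonneg_left this hMpos.le
    have h5 : (M : ℝ) * (-(1 / (n : ℝ)) + 1) = M - M / n := by ring
    linarith
  have h0 : (0 : ℝ) ≤ (M : ℝ) - d := by
    have : (d : ℝ) ≤ M := by exact_mod_cast hle
    linarith
  have h6 : ((M : ℝ) - d) ^ (n * s) ≤ M ^ (n * s) * Real.exp (-s) := by
    calc ((M : ℝ) - d) ^ (n * s) ≤ (M * Real.exp (-(1 / n))) ^ (n * s) :=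
          pow_le_pow_left₀ h0 h3 _
      _ = M ^ (n * s) * Real.exp (-s) := by
          rw [mul_pow, ← Real.exp_nat_mul]
          congr 2
          push_cast
          field_simp
  have hMk : (0 : ℝ) < M ^ (n * s) := pow_pos hMpos _
  have h7 : (M : ℝ) ^ (n * s) * A ≤ M ^ (n * s) * (Real.exp (-s) * Om) := by
    refine h1'.trans ?_
    rw [← mul_assoc]
    exact mul_le_mul_of_nonneg_right h6 (Nat.cast_nonneg _)
  exact le_of_mul_le_mul_left h7 hMk

theorem fiber_le {r : ℕ} (F : Finset (Finset (Fin r))) (n : ℕ) (ρ : RS r n) :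
    (Finset.univ.filter (fun x : XF F n => pF F n x = ρ)).card ≤ Fintype.card (QF F) := by
  have hf := fiber_card F n (fun s => s = ρ)
  have h1 : (Finset.univ.filter (fun s : RS r n => s = ρ)).card = 1 := by
    rw [Finset.filter_eq']; simp
  have h2 : (Finset.univ.filter (fun x : XF F n => pF F n x = ρ)).card =
      (Finset.univ.filter (fun s : RS r n => s = ρ)).card * Fintype.card (QF F) := by
    convert hf
  rw [h2, h1, one_mul]

/-- Real-valued bound for the fraction of bad enumerations. -/
theorem bad_bound {r : ℕ} (hr : 1 ≤ r) (F : Finset (Finset (Fin r))) (n w s : ℕ) (hn : 1 ≤ n)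
    (hM : 2 ≤ Mnum F n) (hw : w ≤ n * s) :
    ((Finset.univ.filter (fun e => couple F n e ∉ goodEv F n w)).card : ℝ) ≤
      (n * Real.exp (-s) + (2 * (n * s)) ^ 2 * (Fintype.card (QF F)) / (Mnum F n - 1)) *
        Fintype.card (Fin (Mnum F n) ≃ XF F n) := by
  set M := Mnum F n with hMdef
  set K := Fintype.card (QF F) with hKdef
  set Om := Fintype.card (Fin M ≃ XF F n) with hOm
  set k := n * s with hk
  let I : Finset (Fin M × Fin M) := Finset.univ.filter
    (fun ij => (ij.1 : ℕ) < 2 * k ∧ (ij.2 : ℕ) < 2 * k ∧ ij.1 ≠ ij.2)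
  have hI : I.card ≤ (2 * k) ^ 2 := by
    calc I.card ≤ (Finset.range (2*k) ×ˢ Finset.range (2*k)).card := by
          apply Finset.card_le_card_of_injOn (fun ij => ((ij.1 : ℕ), (ij.2 : ℕ)))
          · intro a ha
            simp [I] at ha ⊢
            exact ⟨ha.1, ha.2.1⟩
          · rintro ⟨a, b⟩ _ ⟨c, d⟩ _ h
            simpa [Fin.ext_iff] using h
      _ = _ := by simp [sq]
  have hsub : (Finset.univ.filter (fun e => couple F n e ∉ goodEv F n w)) ⊆
      ((Finset.univ : Finset (Fin n)).biUnion (fun v => avoidSet M (starF F v) k)) ∪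
      I.biUnion (fun ij => Finset.univ.filter
        (fun f : Fin M ≃ XF F n => pF F n (f ij.1) = pF F n (f ij.2))) := by
    intro e he
    simp only [Finset.mem_filter, Finset.mem_univ, true_and] at he
    by_contra hc
    apply he
    rw [Finset.mem_union, not_or] at hc
    apply good_of F n w k hw e
    · intro v hv
      exact hc.1 (Finset.mem_biUnion.2 ⟨v, Finset.mem_univ _, hv⟩)
    · intro i j hi hj hij
      by_contra hne
      apply hc.2
      refine Finset.mem_biUnion.2 ⟨(i, j), ?_, ?_⟩
      · simp [I, hi, hj, hne]
      · simpa using hij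
  have hMpos : (0 : ℝ) < M := by exact_mod_cast (by omega : 0 < M)
  have hM1 : (0 : ℝ) < M - 1 := by
    have : (2 : ℝ) ≤ M := by exact_mod_cast hM
    linarith
  have hnpos : (0 : ℝ) < n := by exact_mod_cast hn
  have hA : ∀ v : Fin n, ((avoidSet M (starF F v) k).card : ℝ) ≤ Real.exp (-s) * Om := by
    intro v
    refine avoid_real hr hn (by omega) (star_total hr F v) ?_
      (avoid_bound M (card_XF F n) (starF F v) k)
    exact (Finset.card_le_univ _).trans (card_XF F n).le
  have hB : ∀ ij ∈ I, ((Finset.univ.filter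
        (fun f : Fin M ≃ XF F n => pF F n (f ij.1) = pF F n (f ij.2))).card : ℝ) ≤
        K / (M - 1) * Om := by
    intro ij hij
    have hne : ij.1 ≠ ij.2 := by
      simp [I] at hij
      exact hij.2.2
    have h1 := pair_bound M K (pF F n) (fiber_le F n) ij.1 ij.2 hne
    have h2 := (Nat.cast_le (α := ℝ)).2 h1
    push_cast [Nat.cast_sub (by omega : 1 ≤ M)] at h2
    rw [div_mul_eq_mul_div, le_div_iff₀ hM1, mul_comm]
    exact h2
  have hcard := (Finset.card_le_card hsub).trans (Finset.card_union_le _ _)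
  have hc1 := Finset.card_biUnion_le (s := (Finset.univ : Finset (Fin n)))
    (t := fun v => avoidSet M (starF F v) k)
  have hc2 := Finset.card_biUnion_le (s := I) (t := fun ij => Finset.univ.filter
        (fun f : Fin M ≃ XF F n => pF F n (f ij.1) = pF F n (f ij.2)))
  have hcard' := (Nat.cast_le (α := ℝ)).2 (hcard.trans (add_le_add hc1 hc2))
  push_cast at hcard'
  refine hcard'.trans ?_
  have e1 : ∑ v : Fin n, ((avoidSet M (starF F v) k).card : ℝ) ≤ n * (Real.exp (-s) * Om) := by
    refine (Finset.sum_le_sum (fun v _ => hA v)).trans ?_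
    simp
  have e2 := Finset.sum_le_sum hB
  have e3 : ∑ ij ∈ I, ((K : ℝ) / (M - 1) * Om) ≤ (2 * k) ^ 2 * (K / (M - 1) * Om) := by
    rw [Finset.sum_const, nsmul_eq_mul]
    apply mul_le_mul_of_nonneg_right
    · exact_mod_cast hI
    · positivity
  have e4 : (n * Real.exp (-s) + (2 * ((n : ℝ) * s)) ^ 2 * K / (M - 1)) * Om =
      n * (Real.exp (-s) * Om) + (2 * k) ^ 2 * (K / (M - 1) * Om) := by
    rw [hk]; push_cast; ring
  rw [e4]
  linarith

theorem choose_lower (r n : ℕ) (hr : 4 ≤ r) (hn : 2 * r ≤ n) :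
    (n : ℝ) ^ 4 ≤ 16 * r.factorial * n.choose r := by
  have h := Nat.pow_le_choose (α := ℝ) r n
  have h1 : (n : ℝ) / 2 ≤ ((n + 1 - r : ℕ) : ℝ) := by
    rw [div_le_iff₀ (by norm_num)]
    exact_mod_cast (by omega : n ≤ (n + 1 - r) * 2)
  have h2 : (1 : ℝ) ≤ (n : ℝ) / 2 := by
    rw [le_div_iff₀ (by norm_num)]
    exact_mod_cast (by omega : 1 * 2 ≤ n)
  have h3 : ((n : ℝ) / 2) ^ 4 ≤ ((n + 1 - r : ℕ) : ℝ) ^ r :=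
    (pow_le_pow_right₀ h2 hr).trans (pow_le_pow_left₀ (by positivity) h1 r)
  have h4 : ((n : ℝ) / 2) ^ 4 ≤ r.factorial * n.choose r := by
    have hf : (0 : ℝ) < r.factorial := by exact_mod_cast r.factorial_pos
    rw [div_le_iff₀ hf] at h
    linarith [h3.trans h]
  have h5 : ((n : ℝ) / 2) ^ 4 = n ^ 4 / 16 := by ring
  linarith

theorem g_bound (g : ℕ → ℝ) (hg : GoodG g) :
    ∀ᶠ n : ℕ in atTop, ⌊g n * (n : ℝ)⌋₊ ≤ n * Nat.sqrt n := by
  have hlog : Tendsto (fun n : ℕ => Real.log (n : ℝ)) atTop atTop :=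
    Real.tendsto_log_atTop.comp tendsto_natCast_atTop_atTop
  have hll : Tendsto (fun n : ℕ => Real.log (Real.log (n : ℝ))) atTop atTop :=
    Real.tendsto_log_atTop.comp hlog
  have h1 := hg.2.bound (show (0 : ℝ) < 1 by norm_num)
  have h2 : ∀ᶠ n : ℕ in atTop, ‖Real.log (n : ℝ)‖ ≤ (1 / 2) * ‖(n : ℝ) ^ (1 / 2 : ℝ)‖ :=
    tendsto_natCast_atTop_atTop.eventually
      ((isLittleO_log_rpow_atTop (show (0 : ℝ) < 1 / 2 by norm_num)).bound
        (show (0 : ℝ) < 1 / 2 by norm_num))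
  filter_upwards [h1, h2, hll.eventually_ge_atTop 1, eventually_ge_atTop 4] with n h1 h2 h3 h4
  have h5 : ‖Real.log n / Real.log (Real.log n)‖ ≤ ‖Real.log (n : ℝ)‖ := by
    rw [norm_div]
    apply div_le_self (norm_nonneg _)
    rw [Real.norm_eq_abs]
    exact h3.trans (le_abs_self _)
  have h6 : g n ≤ (1 / 2) * Real.sqrt n := by
    rw [← Real.sqrt_eq_rpow, Real.norm_of_nonneg (Real.sqrt_nonneg _)] at h2
    have := Real.le_norm_self (g n)
    linarith
  have h7 : Real.sqrt n ≤ Nat.sqrt n + 1 := by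
    apply Real.sqrt_le_iff.2
    refine ⟨by positivity, ?_⟩
    have := (Nat.lt_succ_sqrt' n).le
    exact_mod_cast this
  have h8 : (1 : ℝ) ≤ Nat.sqrt n := by
    exact_mod_cast Nat.sqrt_pos.2 (by omega)
  have h9 : g n ≤ Nat.sqrt n := by linarith
  apply Nat.floor_le_of_le
  push_cast
  rw [mul_comm]
  exact mul_le_mul_of_nonneg_left h9 (Nat.cast_nonneg _)

theorem bad_small (r : ℕ) (hr : 4 ≤ r) (F : Finset (Finset (Fin r))) (g : ℕ → ℝ) (hg : GoodG g) :
    ∃ b : ℕ → ℝ, Tendsto b atTop (nhds 0) ∧ ∀ᶠ n : ℕ in atTop,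
      ((Finset.univ.filter (fun e => couple F n e ∉ goodEv F n ⌊g n * (n : ℝ)⌋₊)).card : ℝ) ≤
        b n * Fintype.card (Fin (Mnum F n) ≃ XF F n) := by
  set K := Fintype.card (QF F) with hK
  refine ⟨fun n => 4 * ((Nat.sqrt n : ℝ) ^ 2 * Real.exp (-(Nat.sqrt n : ℝ))) +
    (128 * r.factorial * K) / n, ?_, ?_⟩
  · have hs : Tendsto (fun n : ℕ => (Nat.sqrt n : ℝ)) atTop atTop := by
      apply tendsto_natCast_atTop_atTop.comp
      apply tendsto_atTop.2
      intro b
      filter_upwards [eventually_ge_atTop (b * b)] with n hn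
      exact Nat.le_sqrt.2 hn
    have h1 := ((Real.tendsto_pow_mul_exp_neg_atTop_nhds_zero 2).comp hs).const_mul 4
    have h2 := tendsto_const_div_atTop_nhds_zero_nat (𝕜 := ℝ) (128 * r.factorial * K)
    simpa using h1.add h2
  · filter_upwards [g_bound g hg, eventually_ge_atTop (2 * r), eventually_ge_atTop 4,
      eventually_ge_atTop (32 * r.factorial)] with n h1 h2 h3 h4
    have hKpos : 1 ≤ K := Fintype.card_pos
    have hc := choose_lower r n hr h2
    have hf : (1 : ℝ) ≤ r.factorial := by exact_mod_cast r.factorial_pos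
    have hn : (1 : ℝ) ≤ n := by exact_mod_cast (by omega : 1 ≤ n)
    have h4' : 32 * (r.factorial : ℝ) ≤ n := by exact_mod_cast h4
    have hMc : (n.choose r : ℝ) ≤ Mnum F n := by
      rw [Mnum_eq]; exact_mod_cast Nat.le_mul_of_pos_right _ hKpos
    have hML : (n : ℝ) ^ 4 ≤ 16 * r.factorial * Mnum F n :=
      hc.trans (mul_le_mul_of_nonneg_left hMc (by positivity))
    have hn4 : (n : ℝ) ≤ n ^ 4 := le_self_pow₀ hn (by norm_num)
    have hM2 : (2 : ℝ) ≤ Mnum F n := by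
      by_contra hlt
      push Not at hlt
      nlinarith
    have hb := bad_bound (by omega : 1 ≤ r) F n _ (Nat.sqrt n) (by omega)
      (by exact_mod_cast hM2) h1
    refine hb.trans ?_
    apply mul_le_mul_of_nonneg_right _ (Nat.cast_nonneg _)
    have hs1 : (1 : ℝ) ≤ Nat.sqrt n := by exact_mod_cast Nat.sqrt_pos.2 (by omega)
    have hs2 : (n : ℝ) ≤ ((Nat.sqrt n : ℝ) + 1) ^ 2 := by
      exact_mod_cast (Nat.lt_succ_sqrt' n).le
    have hs3 : ((Nat.sqrt n : ℝ)) ^ 2 ≤ n := by exact_mod_cast Nat.sqrt_le' n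
    apply add_le_add
    · rw [← mul_assoc]
      apply mul_le_mul_of_nonneg_right _ (Real.exp_pos _).le
      nlinarith
    · have hM1 : (0 : ℝ) < Mnum F n - 1 := by linarith
      rw [← hK, div_le_div_iff₀ hM1 (by linarith)]
      have hM3 : (n : ℝ) ^ 4 ≤ 32 * r.factorial * (Mnum F n - 1) := by nlinarith
      have : (2 * ((n : ℝ) * Nat.sqrt n)) ^ 2 * n ≤ 4 * n ^ 4 := by
        calc (2 * ((n : ℝ) * Nat.sqrt n)) ^ 2 * (n : ℝ) = 4 * (n : ℝ) ^ 3 * (Nat.sqrt n : ℝ) ^ 2 := by ring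
          _ ≤ 4 * (n : ℝ) ^ 3 * (n : ℝ) := mul_le_mul_of_nonneg_left hs3 (by positivity)
          _ = _ := by ring
      calc (2 * ((n : ℝ) * Nat.sqrt n)) ^ 2 * (K : ℝ) * (n : ℝ)
          = (K : ℝ) * ((2 * ((n : ℝ) * Nat.sqrt n)) ^ 2 * (n : ℝ)) := by ring
        _ ≤ (K : ℝ) * (4 * (32 * r.factorial * ((Mnum F n : ℝ) - 1))) := by
            apply mul_le_mul_of_nonneg_left _ (Nat.cast_nonneg _)
            linarith
        _ = _ := by ring

/-- One may couple the random `F`-graph process with the random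
`r`-uniform hypergraph process so that whp (a) the hitting times of having no isolated
vertices coincide, and (b) up to time `T_H + ⌊g(n)n⌋` the vertex-set multihypergraph of
the `F`-graph process has no repeated hyperedge and coincides with the hypergraph
process. -/
theorem statement_9 (u r : ℕ) (hu : 2 ≤ u) (hr : 4 ≤ r)
    (F : Finset (Finset (Fin r))) (hFcard : ∀ e ∈ F, e.card = u) (hF : Nice u F)
    (g : ℕ → ℝ) (hg : GoodG g) :
    ∃ μ : (n : ℕ) →
        PMF ((Fin (Mnum F n) → FE n) × (Fin (Nat.choose n r) → Finset (Fin n))),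
      (∀ n, UniformOn (μ n) Prod.fst (ValidOrdH F n)) ∧
      (∀ n, UniformOn (μ n) Prod.snd (ValidOrdR r n)) ∧
      Tendsto (fun n => (μ n).toOuterMeasure
          {ω | THit F n ω.1 = TEHit r n ω.2 ∧
               ∀ t : ℕ, t ≤ THit F n ω.1 + ⌊g n * (n : ℝ)⌋₊ →
                 (∀ h ∈ proc ω.1 t, ∀ h' ∈ proc ω.1 t, h.1 = h'.1 → h = h') ∧
                 (proc ω.1 t).image Prod.fst = proc ω.2 t})
        atTop (nhds 1) := by
  refine ⟨muC F, muC_fst F, muC_snd F, ?_⟩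
  change Tendsto (fun n => (muC F n).toOuterMeasure (goodEv F n ⌊g n * (n : ℝ)⌋₊)) atTop (nhds 1)
  obtain ⟨b, hb0, hb⟩ := bad_small r hr F g hg
  have hlim : Tendsto (fun n => ENNReal.ofReal (1 - b n)) atTop (nhds 1) := by
    have := ENNReal.tendsto_ofReal (tendsto_const_nhds (x := (1 : ℝ)) |>.sub hb0)
    simpa using this
  refine tendsto_of_tendsto_of_tendsto_of_le_of_le' hlim tendsto_const_nhds ?_ ?_
  · filter_upwards [hb] with n hn
    rw [muC_apply]
    set Om := Fintype.card (Fin (Mnum F n) ≃ XF F n) with hOm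
    have hpos : 0 < Om := Fintype.card_pos
    have hsum := Finset.card_filter_add_card_filter_not
      (s := (Finset.univ : Finset (Fin (Mnum F n) ≃ XF F n)))
      (fun e => couple F n e ∈ goodEv F n ⌊g n * (n : ℝ)⌋₊)
    rw [Finset.card_univ, ← hOm] at hsum
    have hsum' := congrArg (Nat.cast (R := ℝ)) hsum
    push_cast at hsum'
    have hposR : (0 : ℝ) < Om := by exact_mod_cast hpos
    rw [← ENNReal.ofReal_natCast, ← ENNReal.ofReal_natCast Om, ← ENNReal.ofReal_div_of_pos hposR]
    apply ENNReal.ofReal_le_ofReal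
    rw [le_div_iff₀ hposR]
    linarith
  · refine Eventually.of_forall (fun n => ?_)
    rw [muC_apply]
    apply ENNReal.div_le_of_le_mul
    rw [one_mul]
    exact_mod_cast Finset.card_le_univ _
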